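/- arXiv:2002.04126 — 5 statements merged into one kernel-verified Lean document; each statement's English description precedes it below -/
import Mathlib

section
/- Let A be a real m×n matrix, b ∈ ℝ^m, and x⋆ ∈ ℝ^n a vector satisfying Aᵀ(b − A x⋆) = 0 (a least-squares solution), with least-squares residual r⋆ = b − A x⋆. Suppose every row Aᵢ of A is nonzero, let w ∈ ℝ^m be a vector of weights, let q ≥ 1 be a natural number, and let τ : Fin q → Fin m be any finite sequence of row indices. Define the weighted sampling matrix M_τ = (1/q) Σ_{j ∈ Fin q} w_{τ(j)} · (e_{τ(j)} e_{τ(j)}ᵀ) / ‖A_{τ(j)}‖², where e_i denotes the i-th standard basis vector of ℝ^m. Then for any x ∈ ℝ^n, the averaged Kaczmarz update x' = x − (1/q) Σ_{j ∈ Fin q} w_{τ(j)} · ((A_{τ(j)} · x − b_{τ(j)}) / ‖A_{τ(j)}‖²) · A_{τ(j)}ᵀ satisfies the error update identity x' − x⋆ = (I − Aᵀ M_τ A)(x − x⋆) + Aᵀ M_τ r⋆. -/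
open Matrix BigOperators

/-- Applying `Aᵀ Eᵢᵢ` to a vector `v` extracts the `i`-th row of `A`, scaled by `v i`. -/
theorem transpose_mulVec_single_mulVec {ι κ R : Type*} [Fintype ι] [DecidableEq ι]
    [CommSemiring R] (A : Matrix ι κ R) (i : ι) (v : ι → R) :
    Aᵀ *ᵥ (Matrix.single i i (1 : R) *ᵥ v) = v i • A i := by
  ext k
  rw [Matrix.single_mulVec]
  simp [Function.update_apply, Matrix.mulVec, dotProduct, mul_comm]

/-- Error update identity for the averaged randomized Kaczmarz step:
`x' − x⋆ = (I − Aᵀ M_τ A)(x − x⋆) + Aᵀ M_τ r⋆`. -/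
theorem averaged_kaczmarz_error_update
    {m n : ℕ} (A : Matrix (Fin m) (Fin n) ℝ) (b : Fin m → ℝ)
    (xstar : Fin n → ℝ) (hxstar : Aᵀ.mulVec (b - A.mulVec xstar) = 0)
    (hrows : ∀ i : Fin m, A i ≠ 0)
    (w : Fin m → ℝ) (q : ℕ) (hq : 1 ≤ q) (τ : Fin q → Fin m)
    (M : Matrix (Fin m) (Fin m) ℝ)
    (hM : M = (q : ℝ)⁻¹ •
      (∑ j : Fin q, (w (τ j) / (∑ l, A (τ j) l ^ 2)) •
        Matrix.single (τ j) (τ j) (1 : ℝ)))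
    (x x' : Fin n → ℝ)
    (hx' : x' = x - (q : ℝ)⁻¹ •
      (∑ j : Fin q, (w (τ j) * ((∑ l, A (τ j) l * x l) - b (τ j)) / (∑ l, A (τ j) l ^ 2)) •
        A (τ j))) :
    x' - xstar = (1 - Aᵀ * M * A).mulVec (x - xstar)
      + (Aᵀ * M).mulVec (b - A.mulVec xstar) := by
  have hstep : (q : ℝ)⁻¹ •
      (∑ j : Fin q, (w (τ j) * ((∑ l, A (τ j) l * x l) - b (τ j)) / (∑ l, A (τ j) l ^ 2)) •
        A (τ j)) = Aᵀ *ᵥ (M *ᵥ (A *ᵥ x - b)) := by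
    rw [hM, smul_mulVec, mulVec_smul, sum_mulVec, mulVec_sum]
    congr 1
    refine Finset.sum_congr rfl fun j _ => ?_
    rw [smul_mulVec, mulVec_smul, transpose_mulVec_single_mulVec, smul_smul]
    simp only [Pi.sub_apply, mulVec, dotProduct]
    congr 1
    ring
  rw [hx', hstep]
  simp only [sub_mulVec, one_mulVec, ← mulVec_mulVec, mulVec_sub]
  abel
end

section
/- Let A be a real m×n matrix with nonzero rows, w ∈ ℝ^m a weight vector, and p ∈ ℝ^m a probability vector (pᵢ ≥ 0, Σᵢ pᵢ = 1). Let q ≥ 1 and, for τ : Fin q → Fin m, define M_τ = (1/q) Σ_{j ∈ Fin q} w_{τ(j)} (e_{τ(j)} e_{τ(j)}ᵀ)/‖A_{τ(j)}‖². Then Σ_{τ : Fin q → Fin m} (Π_{j ∈ Fin q} p_{τ(j)}) · (M_τᵀ A Aᵀ M_τ) = (1/q) P W² D⁻² + (1 − 1/q) P W D⁻² A Aᵀ P W D⁻², where D = Diag(‖A₁‖,…,‖A_m‖), P = Diag(p₁,…,p_m), and W = Diag(w₁,…,w_m). -/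
open Matrix BigOperators

/-- Under the product weights `∏ i, p (τ i)`, distinct coordinates of `τ` are independent. -/
theorem sum_prod_weight_mul_mul {ι α R : Type*} [Fintype ι] [DecidableEq ι] [Fintype α]
    [CommSemiring R] (p : α → R) (hp : ∑ i, p i = 1) (f g : α → R) (j k : ι) :
    ∑ τ : ι → α, (∏ i, p (τ i)) * (f (τ j) * g (τ k)) =
      if j = k then ∑ a, p a * (f a * g a) else (∑ a, p a * f a) * ∑ a, p a * g a := by
  have key : ∑ τ : ι → α, (∏ i, p (τ i)) * (f (τ j) * g (τ k)) =
      ∏ i, ∑ a, p a * ((if i = j then f a else 1) * (if i = k then g a else 1)) := by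
    rw [Finset.prod_univ_sum, Fintype.piFinset_univ]
    refine Finset.sum_congr rfl fun τ _ => ?_
    simp only [Finset.prod_mul_distrib, Finset.prod_ite_eq', Finset.mem_univ, if_true]
  rw [key]
  split_ifs with h
  · subst h
    rw [Finset.prod_eq_single j]
    · simp
    · intro i _ hi
      simp [hi, hp]
    · simp
  · have factor : ∀ i, ∑ a, p a * ((if i = j then f a else 1) * (if i = k then g a else 1)) =
        (if i = j then ∑ a, p a * f a else 1) * (if i = k then ∑ a, p a * g a else 1) := by
      intro i
      by_cases hj : i = j
      · subst hj
        simp [h]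
      · simp only [if_neg hj, one_mul]
        by_cases hk : i = k <;> simp only [hk, if_true, if_false, mul_one, hp]
    simp only [factor, Finset.prod_mul_distrib, Finset.prod_ite_eq', Finset.mem_univ, if_true]

/-- Sum of a two-valued function over ordered pairs, split by equality of the coordinates. -/
theorem sum_sum_ite_eq_real (q : ℕ) (x y : ℝ) :
    ∑ j : Fin q, ∑ k : Fin q, (if j = k then x else y) = q * x + q * (q - 1) * y := by
  have split : ∀ j k : Fin q, (if j = k then x else y) = (if j = k then x - y else 0) + y := by
    intro j k
    split_ifs <;> ring
  simp only [split, Finset.sum_add_distrib, Finset.sum_ite_eq, Finset.mem_univ, if_true,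
    Finset.sum_const, Finset.card_univ, Fintype.card_fin, nsmul_eq_mul]
  ring

/-- The expectation of `M_τᵀ A Aᵀ M_τ` over `τ` with i.i.d. coordinates drawn
from `p` equals `(1/q) P W² D⁻² + (1 − 1/q) P W D⁻² A Aᵀ P W D⁻²`. -/
theorem expectation_MAAM
    {m n : ℕ} (A : Matrix (Fin m) (Fin n) ℝ) (hrows : ∀ i : Fin m, A i ≠ 0)
    (w p : Fin m → ℝ) (hp0 : ∀ i, 0 ≤ p i) (hp1 : ∑ i, p i = 1)
    (q : ℕ) (hq : 1 ≤ q)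
    (M : (Fin q → Fin m) → Matrix (Fin m) (Fin m) ℝ)
    (hM : ∀ τ, M τ = (q : ℝ)⁻¹ •
      (∑ j : Fin q, (w (τ j) / (∑ l, A (τ j) l ^ 2)) •
        Matrix.single (τ j) (τ j) (1 : ℝ)))
    (D P W : Matrix (Fin m) (Fin m) ℝ)
    (hD : D = Matrix.diagonal (fun i => Real.sqrt (∑ l, A i l ^ 2)))
    (hP : P = Matrix.diagonal p) (hW : W = Matrix.diagonal w) :
    ∑ τ : Fin q → Fin m, (∏ j, p (τ j)) • ((M τ)ᵀ * A * Aᵀ * M τ) =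
      (q : ℝ)⁻¹ • (P * W ^ 2 * (D ^ 2)⁻¹)
        + (1 - (q : ℝ)⁻¹) • (P * W * (D ^ 2)⁻¹ * A * Aᵀ * P * W * (D ^ 2)⁻¹) := by
  have hq0 : (q : ℝ) ≠ 0 := by positivity
  have hpos : ∀ i, 0 < ∑ l, A i l ^ 2 := by
    intro i
    obtain ⟨l, hl⟩ := Function.ne_iff.mp (hrows i)
    exact Finset.sum_pos' (fun _ _ => sq_nonneg _)
      ⟨l, Finset.mem_univ l, sq_pos_iff.mpr hl⟩
  set s : Fin m → ℝ := fun i => ∑ l, A i l ^ 2 with hs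
  have hD2 : (D ^ 2)⁻¹ = Matrix.diagonal fun i => (s i)⁻¹ := by
    refine Matrix.inv_eq_right_inv ?_
    rw [hD, Matrix.diagonal_pow, Matrix.diagonal_mul_diagonal, ← Matrix.diagonal_one]
    congr 1
    ext i
    simp only [Pi.pow_apply]
    rw [Real.sq_sqrt (hpos i).le]
    exact mul_inv_cancel₀ (hpos i).ne'
  have hM' : ∀ τ, M τ = Matrix.diagonal fun a =>
      (q : ℝ)⁻¹ * ∑ j, (if τ j = a then w a / s a else 0) := by
    intro τ
    rw [hM]
    ext a b
    simp only [Matrix.smul_apply, Matrix.sum_apply, Matrix.single_apply, Matrix.diagonal_apply,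
      smul_eq_mul]
    split_ifs with hab
    · subst hab
      congr 1
      refine Finset.sum_congr rfl fun j _ => ?_
      by_cases h : τ j = a
      · simp [h, hs]
      · simp [h]
    · rw [Finset.sum_eq_zero, mul_zero]
      intro j _
      rw [if_neg (by rintro ⟨h₁, h₂⟩; exact hab (h₁.symm.trans h₂)), mul_zero]
  have hG : ∀ a, (A * Aᵀ) a a = s a := by
    intro a
    simp [Matrix.mul_apply, hs, sq]
  have hR : P * W * (D ^ 2)⁻¹ = Matrix.diagonal fun a => p a * w a * (s a)⁻¹ := by
    rw [hD2, hP, hW, Matrix.diagonal_mul_diagonal, Matrix.diagonal_mul_diagonal]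
  have hR2 : P * W ^ 2 * (D ^ 2)⁻¹ = Matrix.diagonal fun a => p a * w a ^ 2 * (s a)⁻¹ := by
    rw [hD2, hP, hW, Matrix.diagonal_pow, Matrix.diagonal_mul_diagonal,
      Matrix.diagonal_mul_diagonal]
    rfl
  have hR3 : P * W * (D ^ 2)⁻¹ * A * Aᵀ * P * W * (D ^ 2)⁻¹ =
      (P * W * (D ^ 2)⁻¹) * (A * Aᵀ) * (P * W * (D ^ 2)⁻¹) := by
    simp only [Matrix.mul_assoc]
  rw [hR3, hR2, hR]
  ext a b
  have hL : ∀ τ, ((M τ)ᵀ * A * Aᵀ * M τ) a b =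
      (q : ℝ)⁻¹ ^ 2 * (A * Aᵀ) a b *
        ∑ j, ∑ k, (if τ j = a then w a / s a else 0) * (if τ k = b then w b / s b else 0) := by
    intro τ
    rw [Matrix.mul_assoc (M τ)ᵀ, hM', Matrix.diagonal_transpose, Matrix.mul_diagonal,
      Matrix.diagonal_mul, ← Finset.sum_mul_sum]
    ring
  have hE : ∑ τ : Fin q → Fin m, (∏ j, p (τ j)) *
      (∑ j, ∑ k, (if τ j = a then w a / s a else 0) * (if τ k = b then w b / s b else 0)) =
      q * (if a = b then p a * (w a / s a) ^ 2 else 0) +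
        q * (q - 1) * ((p a * (w a / s a)) * (p b * (w b / s b))) := by
    rw [← sum_sum_ite_eq_real]
    simp only [Finset.mul_sum]
    rw [Finset.sum_comm]
    refine Finset.sum_congr rfl fun j _ => ?_
    rw [Finset.sum_comm]
    refine Finset.sum_congr rfl fun k _ => ?_
    rw [sum_prod_weight_mul_mul p hp1 (fun i => if i = a then w a / s a else 0)
      (fun i => if i = b then w b / s b else 0) j k]
    congr 1
    · simp only [ite_mul, zero_mul, mul_ite, mul_zero, Finset.sum_ite_eq', Finset.mem_univ,
        if_true]
      by_cases hab : a = b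
      · subst hab
        simp [sq]
      · simp [hab, Ne.symm hab]
    · simp
  rw [Matrix.sum_apply]
  simp only [Matrix.smul_apply, smul_eq_mul, hL, Matrix.add_apply, Matrix.mul_diagonal,
    Matrix.diagonal_mul]
  simp only [mul_left_comm _ ((q : ℝ)⁻¹ ^ 2 * (A * Aᵀ) a b)]
  rw [← Finset.mul_sum, hE, Matrix.diagonal_apply]
  by_cases hab : a = b
  · subst hab
    have hsa : s a ≠ 0 := (hpos a).ne'
    rw [if_pos rfl, if_pos rfl, hG]
    field_simp
  · have hsa : s a ≠ 0 := (hpos a).ne'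
    have hsb : s b ≠ 0 := (hpos b).ne'
    rw [if_neg hab, if_neg hab]
    field_simp
    ring
end

section
/- Let A be a real m×n matrix with nonzero rows and Frobenius norm ‖A‖_F, let w ∈ ℝ^m be a weight vector and p ∈ ℝ^m a probability vector, and suppose the coupling condition P W D⁻² = (α/‖A‖_F²) I holds for some α > 0, where D = Diag(‖A₁‖,…,‖A_m‖), P = Diag(p₁,…,p_m), W = Diag(w₁,…,w_m). Let q ≥ 1 and define M_τ = (1/q) Σ_{j ∈ Fin q} w_{τ(j)} (e_{τ(j)} e_{τ(j)}ᵀ)/‖A_{τ(j)}‖². Then for every e ∈ ℝ^n, Σ_{τ : Fin q → Fin m} (Π_j p_{τ(j)}) · ‖(I − Aᵀ M_τ A) e‖² = ⟨e, ((I − α AᵀA/‖A‖_F²)² + (Aᵀ/‖A‖_F) ((α/q) W − (α²/q) A Aᵀ/‖A‖_F²) (A/‖A‖_F)) e⟩. -/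
open Matrix BigOperators

/-- The second moment of a shifted sum of `q` i.i.d. draws from a finite distribution. -/
theorem sum_prod_mul_add_sum_sq {ι : Type*} [Fintype ι] (p f : ι → ℝ)
    (hp1 : ∑ i, p i = 1) (q : ℕ) (x : ℝ) :
    ∑ τ : Fin q → ι, (∏ j, p (τ j)) * (x + ∑ j, f (τ j)) ^ 2 =
      (x + q * ∑ i, p i * f i) ^ 2 +
        q * (∑ i, p i * f i ^ 2 - (∑ i, p i * f i) ^ 2) := by
  induction q generalizing x with
  | zero => simp
  | succ q ih =>
    set μ := ∑ i, p i * f i with hμ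
    set s := ∑ i, p i * f i ^ 2 with hs
    rw [← (Fin.consEquiv fun _ : Fin (q + 1) => ι).sum_comp, Fintype.sum_prod_type]
    have h : ∀ i, ∑ τ : Fin q → ι,
        (∏ j, p ((Fin.consEquiv fun _ : Fin (q + 1) => ι) (i, τ) j)) *
          (x + ∑ j, f ((Fin.consEquiv fun _ : Fin (q + 1) => ι) (i, τ) j)) ^ 2 =
        p i * ((x + q * μ) ^ 2 + q * (s - μ ^ 2)) + 2 * (x + q * μ) * (p i * f i)
          + p i * f i ^ 2 := by
      intro i
      have h' := ih (x + f i)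
      calc _ = p i * ∑ τ : Fin q → ι, (∏ j, p (τ j)) * (x + f i + ∑ j, f (τ j)) ^ 2 := by
            rw [Finset.mul_sum]
            refine Finset.sum_congr rfl fun τ _ => ?_
            simp only [Fin.consEquiv_apply, Fin.prod_univ_succ, Fin.sum_univ_succ,
              Fin.cons_zero, Fin.cons_succ]
            ring
        _ = _ := by rw [h']; ring
    rw [Finset.sum_congr rfl fun i _ => h i, Finset.sum_add_distrib, Finset.sum_add_distrib,
      ← Finset.sum_mul, ← Finset.mul_sum, hp1, ← hμ, ← hs]
    push_cast
    ring

/-- Under the coupling condition `P W D⁻² = (α/‖A‖_F²) I`, the expectation of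
`‖(I − Aᵀ M_τ A) e‖²` equals
`⟨e, ((I − α AᵀA/‖A‖_F²)² + (Aᵀ/‖A‖_F)((α/q) W − (α²/q) A Aᵀ/‖A‖_F²)(A/‖A‖_F)) e⟩`. -/
theorem expectation_contraction_term
    {m n : ℕ} (A : Matrix (Fin m) (Fin n) ℝ) (hrows : ∀ i : Fin m, A i ≠ 0)
    (w p : Fin m → ℝ) (hp0 : ∀ i, 0 ≤ p i) (hp1 : ∑ i, p i = 1)
    (F : ℝ) (hF : F = ∑ i, ∑ j, A i j ^ 2)
    (D P W : Matrix (Fin m) (Fin m) ℝ)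
    (hD : D = Matrix.diagonal (fun i => Real.sqrt (∑ l, A i l ^ 2)))
    (hP : P = Matrix.diagonal p) (hW : W = Matrix.diagonal w)
    (α : ℝ) (hα : 0 < α)
    (hcouple : P * W * (D ^ 2)⁻¹ = (α / F) • (1 : Matrix (Fin m) (Fin m) ℝ))
    (q : ℕ) (hq : 1 ≤ q)
    (M : (Fin q → Fin m) → Matrix (Fin m) (Fin m) ℝ)
    (hM : ∀ τ, M τ = (q : ℝ)⁻¹ •
      (∑ j : Fin q, (w (τ j) / (∑ l, A (τ j) l ^ 2)) •
        Matrix.single (τ j) (τ j) (1 : ℝ))) :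
    ∀ e : Fin n → ℝ,
      ∑ τ : Fin q → Fin m, (∏ j, p (τ j)) *
          (∑ i, (((1 - Aᵀ * M τ * A).mulVec e) i) ^ 2) =
        e ⬝ᵥ ((((1 : Matrix (Fin n) (Fin n) ℝ) - (α / F) • (Aᵀ * A)) ^ 2
          + F⁻¹ • (Aᵀ * ((α / (q : ℝ)) • W - (α ^ 2 / ((q : ℝ) * F)) • (A * Aᵀ)) * A)).mulVec e) := by
  intro e
  have hs : ∀ i, 0 < ∑ l, A i l ^ 2 := by
    intro i
    obtain ⟨l, hl⟩ := Function.ne_iff.mp (hrows i)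
    exact Finset.sum_pos' (fun _ _ => sq_nonneg _) ⟨l, Finset.mem_univ l, sq_pos_of_ne_zero hl⟩
  have hq0 : (q : ℝ) ≠ 0 := by positivity
  set s : Fin m → ℝ := fun i => ∑ l, A i l ^ 2 with hsdef
  have hpc : ∀ i, p i * (w i / s i) = α / F := by
    intro i
    have hD2 : (D ^ 2)⁻¹ = Matrix.diagonal fun i => (s i)⁻¹ := by
      apply Matrix.inv_eq_right_inv
      rw [hD, Matrix.diagonal_pow, Matrix.diagonal_mul_diagonal, ← Matrix.diagonal_one]
      congr 1
      funext i
      simp only [Pi.pow_apply, Real.sq_sqrt (hs i).le]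
      exact mul_inv_cancel₀ (hs i).ne'
    have h := congrFun (congrFun hcouple i) i
    rw [hD2, hP, hW, Matrix.diagonal_mul_diagonal, Matrix.diagonal_mul_diagonal] at h
    simp only [Matrix.diagonal_apply_eq, Matrix.smul_apply, Matrix.one_apply_eq, smul_eq_mul,
      mul_one] at h
    rw [← h]
    ring
  set y : Fin m → ℝ := A *ᵥ e with hy
  set z : Fin n → ℝ := Aᵀ *ᵥ y with hz
  set g : Fin n → Fin m → ℝ := fun i a => -((q : ℝ)⁻¹ * (w a / s a) * y a * A a i) with hg
  have hcoord : ∀ τ i, ((1 - Aᵀ * M τ * A) *ᵥ e) i = e i + ∑ j, g i (τ j) := by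
    intro τ i
    rw [Matrix.sub_mulVec, Matrix.one_mulVec, ← Matrix.mulVec_mulVec, ← Matrix.mulVec_mulVec,
      ← hy, hM, Matrix.smul_mulVec, Matrix.mulVec_smul, Matrix.sum_mulVec, Matrix.mulVec_sum]
    simp only [Pi.sub_apply, Pi.smul_apply, Finset.sum_apply, smul_eq_mul, sub_eq_add_neg,
      Finset.mul_sum, hg, Finset.sum_neg_distrib]
    congr 2
    refine Finset.sum_congr rfl fun j _ => ?_
    rw [Matrix.smul_mulVec, Matrix.mulVec_smul, Matrix.single_mulVec]
    simp only [one_mul, Pi.smul_apply, smul_eq_mul, ← Pi.single.eq_1, Matrix.mulVec_single,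
      Matrix.transpose_apply, Matrix.col_apply, MulOpposite.smul_eq_mul_unop,
      MulOpposite.unop_op]
    ring
  have hmean : ∀ i, ∑ a, p a * g i a = -((q : ℝ)⁻¹ * (α / F) * z i) := by
    intro i
    simp only [hz, Matrix.mulVec, dotProduct, Matrix.transpose_apply, Finset.mul_sum,
      ← Finset.sum_neg_distrib, hg]
    refine Finset.sum_congr rfl fun a _ => ?_
    rw [← hpc a]
    ring
  have hsecond : ∑ i, ∑ a, p a * g i a ^ 2 =
      (q : ℝ)⁻¹ ^ 2 * (α / F) * ∑ a, w a * y a ^ 2 := by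
    rw [Finset.sum_comm, Finset.mul_sum]
    refine Finset.sum_congr rfl fun a _ => ?_
    have hsa : s a ≠ 0 := (hs a).ne'
    calc ∑ i, p a * g i a ^ 2
        = (q : ℝ)⁻¹ ^ 2 * (p a * (w a / s a)) * (w a / s a) * y a ^ 2 * s a := by
          simp only [hg, hsdef, Finset.mul_sum]
          exact Finset.sum_congr rfl fun i _ => by ring
      _ = _ := by
          rw [hpc a]
          field_simp
  have hleft : ∑ τ : Fin q → Fin m, (∏ j, p (τ j)) *
      (∑ i, (((1 - Aᵀ * M τ * A).mulVec e) i) ^ 2) =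
      ∑ i, (e i - α / F * z i) ^ 2 + (q : ℝ)⁻¹ * (α / F) * ∑ a, w a * y a ^ 2
        - (q : ℝ)⁻¹ * (α / F) ^ 2 * ∑ i, z i ^ 2 := by
    conv_lhs => simp only [hcoord, Finset.mul_sum]
    rw [Finset.sum_comm]
    simp only [sum_prod_mul_add_sum_sq p _ hp1]
    rw [Finset.sum_add_distrib, ← Finset.mul_sum, Finset.sum_sub_distrib, hsecond]
    simp only [hmean]
    have h₁ : ∀ i, (e i + q * -((q : ℝ)⁻¹ * (α / F) * z i)) = e i - α / F * z i := by
      intro i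
      field_simp
      ring
    have h₂ : ∑ i, (-((q : ℝ)⁻¹ * (α / F) * z i)) ^ 2 =
        (q : ℝ)⁻¹ ^ 2 * (α / F) ^ 2 * ∑ i, z i ^ 2 := by
      rw [Finset.mul_sum]
      exact Finset.sum_congr rfl fun i _ => by ring
    have h₃ : (q : ℝ) * (q : ℝ)⁻¹ ^ 2 = (q : ℝ)⁻¹ := by field_simp
    simp only [h₁, h₂]
    linear_combination ((α / F) * (∑ a, w a * y a ^ 2) - (α / F) ^ 2 * ∑ i, z i ^ 2) * h₃
  rw [hleft, Matrix.add_mulVec, dotProduct_add]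
  have hB : (1 - (α / F) • (Aᵀ * A)) *ᵥ e = e - (α / F) • z := by
    rw [Matrix.sub_mulVec, Matrix.one_mulVec, Matrix.smul_mulVec, ← Matrix.mulVec_mulVec]
  have hBT : (1 - (α / F) • (Aᵀ * A))ᵀ = 1 - (α / F) • (Aᵀ * A) := by
    simp [Matrix.transpose_mul]
  have hfirst : e ⬝ᵥ ((1 - (α / F) • (Aᵀ * A)) ^ 2) *ᵥ e = ∑ i, (e i - α / F * z i) ^ 2 := by
    rw [pow_two, ← Matrix.mulVec_mulVec, Matrix.dotProduct_mulVec, ← Matrix.mulVec_transpose,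
      hBT, hB]
    simp [dotProduct, pow_two]
  have hyy : y ⬝ᵥ W *ᵥ y = ∑ a, w a * y a ^ 2 := by
    rw [hW]
    simp only [dotProduct, Matrix.mulVec_diagonal]
    exact Finset.sum_congr rfl fun a _ => by ring
  have hzz : y ⬝ᵥ A *ᵥ z = ∑ i, z i ^ 2 := by
    rw [Matrix.dotProduct_mulVec, ← Matrix.mulVec_transpose]
    simp [dotProduct, pow_two, ← hz]
  rw [hfirst, Matrix.smul_mulVec, dotProduct_smul, ← Matrix.mulVec_mulVec,
    ← Matrix.mulVec_mulVec, Matrix.dotProduct_mulVec, ← Matrix.mulVec_transpose,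
    Matrix.transpose_transpose, ← hy, Matrix.sub_mulVec, Matrix.smul_mulVec, Matrix.smul_mulVec,
    ← Matrix.mulVec_mulVec, ← hz, dotProduct_sub, dotProduct_smul, dotProduct_smul, hyy, hzz]
  simp only [smul_eq_mul]
  ring
end

section
/- Let A be a real m×n matrix with nonzero rows and Frobenius norm ‖A‖_F, and suppose P W D⁻² = (α/‖A‖_F²) I for some α > 0, where D = Diag(‖A₁‖,…,‖A_m‖), P = Diag(p₁,…,p_m) with p a probability vector, and W = Diag(w₁,…,w_m). Let q ≥ 1 and define M_τ = (1/q) Σ_{j ∈ Fin q} w_{τ(j)} (e_{τ(j)} e_{τ(j)}ᵀ)/‖A_{τ(j)}‖². Then for every r⋆ ∈ ℝ^m with Aᵀ r⋆ = 0, Σ_{τ : Fin q → Fin m} (Π_j p_{τ(j)}) · ‖Aᵀ M_τ r⋆‖² = (α/q) · ⟨r⋆, W r⋆⟩ / ‖A‖_F². -/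
open Matrix BigOperators

/-- Summing over `Fin (q + 1) → ι` is summing over the first value and the remaining ones. -/
lemma sum_fin_succ_pi {ι : Type*} [Fintype ι] {q : ℕ} (f : (Fin (q + 1) → ι) → ℝ) :
    ∑ τ, f τ = ∑ i : ι, ∑ σ : Fin q → ι, f (Fin.cons i σ) := by
  rw [← Fintype.sum_prod_type']
  exact (Fintype.sum_equiv (Fin.consEquiv (fun _ => ι)) _ _ (fun _ => rfl)).symm

/-- Product weights have total mass one. -/
lemma sum_prod_weights {ι : Type*} [Fintype ι] (p : ι → ℝ) (hp : ∑ i, p i = 1) (q : ℕ) :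
    ∑ τ : Fin q → ι, ∏ j, p (τ j) = 1 := by
  induction q with
  | zero => simp
  | succ q ih =>
    simp [sum_fin_succ_pi, Fin.prod_univ_succ, ← Finset.mul_sum, ih, hp]

/-- A sum of independent centered variables is centered. -/
lemma sum_prod_mul_sum_eq_zero {ι : Type*} [Fintype ι] (p g : ι → ℝ) (hp : ∑ i, p i = 1)
    (hg : ∑ i, p i * g i = 0) (q : ℕ) :
    ∑ τ : Fin q → ι, (∏ j, p (τ j)) * ∑ j, g (τ j) = 0 := by
  induction q with
  | zero => simp
  | succ q ih =>
    have h (i : ι) : ∑ σ : Fin q → ι, (p i * ∏ j, p (σ j)) * (g i + ∑ j, g (σ j)) = p i * g i := by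
      calc _ = p i * g i * (∑ σ : Fin q → ι, ∏ j, p (σ j)) +
            p i * ∑ σ : Fin q → ι, (∏ j, p (σ j)) * ∑ j, g (σ j) := by
            rw [Finset.mul_sum, Finset.mul_sum, ← Finset.sum_add_distrib]
            exact Finset.sum_congr rfl fun _ _ => by ring
        _ = _ := by rw [ih, sum_prod_weights p hp]; ring
    simp [sum_fin_succ_pi, Fin.prod_univ_succ, Fin.sum_univ_succ, h, hg]

/-- The second moment of a sum of `q` i.i.d. centered variables is `q` times that of one. -/
lemma sum_prod_mul_sum_sq {ι : Type*} [Fintype ι] (p g : ι → ℝ) (hp : ∑ i, p i = 1)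
    (hg : ∑ i, p i * g i = 0) (q : ℕ) :
    ∑ τ : Fin q → ι, (∏ j, p (τ j)) * (∑ j, g (τ j)) ^ 2 = q * ∑ i, p i * g i ^ 2 := by
  induction q with
  | zero => simp
  | succ q ih =>
    have h (i : ι) : ∑ σ : Fin q → ι, (p i * ∏ j, p (σ j)) * (g i + ∑ j, g (σ j)) ^ 2 =
        p i * g i ^ 2 + p i * (q * ∑ i, p i * g i ^ 2) := by
      calc _ = p i * g i ^ 2 * (∑ σ : Fin q → ι, ∏ j, p (σ j)) +
            2 * p i * g i * (∑ σ : Fin q → ι, (∏ j, p (σ j)) * ∑ j, g (σ j)) +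
            p i * ∑ σ : Fin q → ι, (∏ j, p (σ j)) * (∑ j, g (σ j)) ^ 2 := by
            simp only [Finset.mul_sum (s := (Finset.univ : Finset (Fin q → ι))),
              ← Finset.sum_add_distrib]
            exact Finset.sum_congr rfl fun _ _ => by ring
        _ = _ := by rw [ih, sum_prod_mul_sum_eq_zero p g hp hg, sum_prod_weights p hp]; ring
    simp only [sum_fin_succ_pi, Fin.prod_univ_succ, Fin.sum_univ_succ, Fin.cons_zero,
      Fin.cons_succ, h]
    rw [Finset.sum_add_distrib, ← Finset.sum_mul, hp]
    push_cast
    ring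

/-- Under the coupling condition `P W D⁻² = (α/‖A‖_F²) I`, for any `r⋆` with
`Aᵀ r⋆ = 0`, the expectation of `‖Aᵀ M_τ r⋆‖²` equals `(α/q)⟨r⋆, W r⋆⟩/‖A‖_F²`. -/
theorem expectation_residual_term
    {m n : ℕ} (A : Matrix (Fin m) (Fin n) ℝ) (hrows : ∀ i : Fin m, A i ≠ 0)
    (w p : Fin m → ℝ) (hp0 : ∀ i, 0 ≤ p i) (hp1 : ∑ i, p i = 1)
    (F : ℝ) (hF : F = ∑ i, ∑ j, A i j ^ 2)
    (D P W : Matrix (Fin m) (Fin m) ℝ)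
    (hD : D = Matrix.diagonal (fun i => Real.sqrt (∑ l, A i l ^ 2)))
    (hP : P = Matrix.diagonal p) (hW : W = Matrix.diagonal w)
    (α : ℝ) (hα : 0 < α)
    (hcouple : P * W * (D ^ 2)⁻¹ = (α / F) • (1 : Matrix (Fin m) (Fin m) ℝ))
    (q : ℕ) (hq : 1 ≤ q)
    (M : (Fin q → Fin m) → Matrix (Fin m) (Fin m) ℝ)
    (hM : ∀ τ, M τ = (q : ℝ)⁻¹ •
      (∑ j : Fin q, (w (τ j) / (∑ l, A (τ j) l ^ 2)) •
        Matrix.single (τ j) (τ j) (1 : ℝ))) :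
    ∀ rstar : Fin m → ℝ, Aᵀ.mulVec rstar = 0 →
      ∑ τ : Fin q → Fin m, (∏ j, p (τ j)) *
          (∑ i, ((Aᵀ * M τ).mulVec rstar i) ^ 2) =
        (α / (q : ℝ)) * (rstar ⬝ᵥ W.mulVec rstar) / F := by
  intro r hr
  have hs (i : Fin m) : 0 < ∑ l, A i l ^ 2 := by
    obtain ⟨l, hl⟩ := Function.ne_iff.mp (hrows i)
    exact Finset.sum_pos' (fun _ _ => sq_nonneg _) ⟨l, Finset.mem_univ _, sq_pos_of_ne_zero hl⟩
  have hc (i : Fin m) : p i * (w i / ∑ l, A i l ^ 2) = α / F := by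
    have hD2 : (D ^ 2)⁻¹ = Matrix.diagonal fun i => (∑ l, A i l ^ 2)⁻¹ := by
      apply Matrix.inv_eq_right_inv
      rw [hD, Matrix.diagonal_pow, Matrix.diagonal_mul_diagonal, ← Matrix.diagonal_one]
      congr 1
      funext i
      simp [Real.sq_sqrt (hs i).le, (hs i).ne']
    have h := congrFun (congrFun hcouple i) i
    rw [hD2, hP, hW, Matrix.diagonal_mul_diagonal, Matrix.diagonal_mul_diagonal] at h
    simpa [div_eq_mul_inv, mul_assoc] using h
  have hq0 : (q : ℝ) ≠ 0 := by positivity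
  set g : Fin n → Fin m → ℝ := fun k i => w i / (∑ l, A i l ^ 2) * (A i k * r i) with hgdef
  have hg (k : Fin n) : ∑ i, p i * g k i = 0 := by
    simp only [hgdef, ← mul_assoc, hc]
    simp only [mul_assoc, ← Finset.mul_sum]
    have h := congrFun hr k
    simp only [Matrix.mulVec, dotProduct, Matrix.transpose_apply, Pi.zero_apply] at h
    rw [h, mul_zero]
  have hv (τ : Fin q → Fin m) (k : Fin n) :
      (Aᵀ * M τ).mulVec r k = (q : ℝ)⁻¹ * ∑ j, g k (τ j) := by
    rw [hM, Matrix.mul_smul, Matrix.smul_mulVec, Matrix.mul_sum, Matrix.sum_mulVec]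
    simp only [Pi.smul_apply, Finset.sum_apply, smul_eq_mul, Matrix.mul_smul,
      Matrix.smul_mulVec, ← Matrix.mulVec_mulVec, Matrix.single_mulVec]
    have hupd (i : Fin m) : (Aᵀ *ᵥ Function.update 0 i (r i)) k = A i k * r i := by
      change (Aᵀ *ᵥ Pi.single i (r i)) k = _
      simp [Matrix.mulVec_single]
    simp [hgdef, hupd]
  have hvar (i : Fin m) : ∑ k, p i * g k i ^ 2 = α / F * (r i * (w i * r i)) := by
    have h : ∑ k, p i * g k i ^ 2 =
        p i * (w i / ∑ l, A i l ^ 2) * (r i * ((w i / ∑ l, A i l ^ 2) * (∑ l, A i l ^ 2) * r i)) := by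
      calc _ = ∑ k, p i * (w i / ∑ l, A i l ^ 2) ^ 2 * r i ^ 2 * A i k ^ 2 :=
            Finset.sum_congr rfl fun _ _ => by simp only [hgdef]; ring
        _ = _ := by rw [← Finset.mul_sum]; ring
    rw [h, hc, div_mul_cancel₀ _ (hs i).ne']
  calc _ = ∑ k, (q : ℝ)⁻¹ ^ 2 *
        ∑ τ : Fin q → Fin m, (∏ j, p (τ j)) * (∑ j, g k (τ j)) ^ 2 := by
        simp only [hv, Finset.mul_sum (s := (Finset.univ : Finset (Fin n))),
          Finset.mul_sum (s := (Finset.univ : Finset (Fin q → Fin m)))]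
        rw [Finset.sum_comm]
        exact Finset.sum_congr rfl fun _ _ => Finset.sum_congr rfl fun _ _ => by ring
    _ = (q : ℝ)⁻¹ * ∑ i, ∑ k, p i * g k i ^ 2 := by
        rw [Finset.sum_comm, Finset.mul_sum]
        refine Finset.sum_congr rfl fun k _ => ?_
        rw [sum_prod_mul_sum_sq p (g k) hp1 (hg k)]
        field_simp
    _ = _ := by
        simp only [hvar, ← Finset.mul_sum, hW, dotProduct, Matrix.mulVec_diagonal]
        ring
end

section
/- Let A be a real m×n matrix with nonzero rows and Frobenius norm ‖A‖_F, and suppose P W D⁻² = (α/‖A‖_F²) I for some α > 0, where D = Diag(‖A₁‖,…,‖A_m‖), P = Diag(p₁,…,p_m) with p a probability vector, and W = Diag(w₁,…,w_m). Let q ≥ 1 and define M_τ = (1/q) Σ_{j ∈ Fin q} w_{τ(j)} (e_{τ(j)} e_{τ(j)}ᵀ)/‖A_{τ(j)}‖². Then for every e ∈ ℝ^n and every r⋆ ∈ ℝ^m with Aᵀ r⋆ = 0, Σ_{τ : Fin q → Fin m} (Π_j p_{τ(j)}) · ⟨Aᵀ M_τ A e, Aᵀ M_τ r⋆⟩ =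 (α/q) · ⟨A e, W r⋆⟩ / ‖A‖_F². -/
open Matrix BigOperators

/-- Two coordinates of an i.i.d. tuple, one of them carrying a centred function, are uncorrelated
unless they coincide. -/
theorem sum_prod_mul_apply_mul_apply {ι κ : Type*} [Fintype ι] [Fintype κ] [DecidableEq κ]
    (p x y : ι → ℝ) (hp : ∑ i, p i = 1) (hy : ∑ i, p i * y i = 0) (j k : κ) :
    ∑ τ : κ → ι, (∏ l, p (τ l)) * (x (τ j) * y (τ k)) =
      if j = k then ∑ i, p i * (x i * y i) else 0 := by
  have key : ∑ τ : κ → ι, (∏ l, p (τ l)) * (x (τ j) * y (τ k)) =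
      ∏ l, ∑ i, p i * ((if l = j then x i else 1) * (if l = k then y i else 1)) := by
    rw [Fintype.prod_sum]
    refine Finset.sum_congr rfl fun τ _ => ?_
    rw [Finset.prod_mul_distrib, Finset.prod_mul_distrib]
    simp
  rw [key]
  split_ifs with h
  · subst h
    rw [Finset.prod_eq_single j]
    · simp
    · intro l _ hl
      simp [hl, hp]
    · simp
  · refine Finset.prod_eq_zero (Finset.mem_univ k) ?_
    simp [Ne.symm h, hy]

/-- The covariance of two sums over an i.i.d. tuple, the second one of a centred function. -/
theorem sum_prod_mul_sum_mul_sum {ι κ : Type*} [Fintype ι] [Fintype κ] [DecidableEq κ]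
    (p x y : ι → ℝ) (hp : ∑ i, p i = 1) (hy : ∑ i, p i * y i = 0) :
    ∑ τ : κ → ι, (∏ l, p (τ l)) * ((∑ j, x (τ j)) * ∑ k, y (τ k)) =
      Fintype.card κ * ∑ i, p i * (x i * y i) := by
  simp_rw [Finset.sum_mul_sum, Finset.mul_sum (Finset.univ : Finset κ)]
  rw [Finset.sum_comm]
  simp_rw [Finset.sum_comm (s := (Finset.univ : Finset (κ → ι))),
    sum_prod_mul_apply_mul_apply p x y hp hy]
  simp

/-- The transpose of `A` applied to a combination of coordinate projections is a combination of
rows of `A`. -/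
theorem transpose_mul_sum_single_mulVec {ι κ ν : Type*} [Fintype ι] [DecidableEq ι] [Fintype κ]
    (A : Matrix ι ν ℝ) (a : ℝ) (c : ι → ℝ) (τ : κ → ι) (v : ι → ℝ) (l : ν) :
    ((Aᵀ * (a • ∑ j, c (τ j) • Matrix.single (τ j) (τ j) (1 : ℝ))) *ᵥ v) l =
      a * ∑ j, c (τ j) * v (τ j) * A (τ j) l := by
  rw [← Matrix.mulVec_mulVec, Matrix.smul_mulVec, Matrix.mulVec_smul, Matrix.sum_mulVec,
    Matrix.mulVec_sum, Pi.smul_apply, Finset.sum_apply, smul_eq_mul]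
  congr 1
  refine Finset.sum_congr rfl fun j _ => ?_
  rw [Matrix.smul_mulVec, Matrix.mulVec_smul, Matrix.single_mulVec]
  simp [Matrix.mulVec, dotProduct, Function.update_apply]
  ring

/-- Under the coupling condition `P W D⁻² = (α/‖A‖_F²) I`, for any `e` and any
`r⋆` with `Aᵀ r⋆ = 0`, the expectation of `⟨Aᵀ M_τ A e, Aᵀ M_τ r⋆⟩` equals
`(α/q)⟨A e, W r⋆⟩/‖A‖_F²`. -/
theorem expectation_cross_term
    {m n : ℕ} (A : Matrix (Fin m) (Fin n) ℝ) (hrows : ∀ i : Fin m, A i ≠ 0)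
    (w p : Fin m → ℝ) (hp0 : ∀ i, 0 ≤ p i) (hp1 : ∑ i, p i = 1)
    (F : ℝ) (hF : F = ∑ i, ∑ j, A i j ^ 2)
    (D P W : Matrix (Fin m) (Fin m) ℝ)
    (hD : D = Matrix.diagonal (fun i => Real.sqrt (∑ l, A i l ^ 2)))
    (hP : P = Matrix.diagonal p) (hW : W = Matrix.diagonal w)
    (α : ℝ) (hα : 0 < α)
    (hcouple : P * W * (D ^ 2)⁻¹ = (α / F) • (1 : Matrix (Fin m) (Fin m) ℝ))
    (q : ℕ) (hq : 1 ≤ q)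
    (M : (Fin q → Fin m) → Matrix (Fin m) (Fin m) ℝ)
    (hM : ∀ τ, M τ = (q : ℝ)⁻¹ •
      (∑ j : Fin q, (w (τ j) / (∑ l, A (τ j) l ^ 2)) •
        Matrix.single (τ j) (τ j) (1 : ℝ))) :
    ∀ (e : Fin n → ℝ) (rstar : Fin m → ℝ), Aᵀ.mulVec rstar = 0 →
      ∑ τ : Fin q → Fin m, (∏ j, p (τ j)) *
          ((Aᵀ * M τ * A).mulVec e ⬝ᵥ (Aᵀ * M τ).mulVec rstar) =
        (α / (q : ℝ)) * (A.mulVec e ⬝ᵥ W.mulVec rstar) / F := by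
  intro e rstar hr
  subst hD hP hW
  set s : Fin m → ℝ := fun i => ∑ l, A i l ^ 2 with hs
  have hs_pos : ∀ i, 0 < s i := fun i => by
    obtain ⟨l, hl⟩ := Function.ne_iff.mp (hrows i)
    exact Finset.sum_pos' (fun _ _ => sq_nonneg _) ⟨l, Finset.mem_univ l, sq_pos_of_ne_zero hl⟩
  have hc : ∀ i, p i * (w i / s i) = α / F := fun i => by
    have hD2 : (Matrix.diagonal (fun i => Real.sqrt (s i)) ^ 2)⁻¹ =
        Matrix.diagonal fun i => (s i)⁻¹ := by
      refine Matrix.inv_eq_right_inv ?_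
      rw [Matrix.diagonal_pow, Matrix.diagonal_mul_diagonal, ← Matrix.diagonal_one]
      congr 1
      ext k
      simp [Real.sq_sqrt (hs_pos k).le, (hs_pos k).ne']
    have h := congrFun (congrFun hcouple i) i
    rw [hD2, Matrix.diagonal_mul_diagonal, Matrix.diagonal_mul_diagonal] at h
    simp only [Matrix.diagonal_apply_eq, Matrix.smul_apply, Matrix.one_apply_eq, smul_eq_mul,
      mul_one] at h
    rw [← h]
    ring
  set u := A *ᵥ e
  set x : Fin n → Fin m → ℝ := fun l i => w i / s i * u i * A i l
  set y : Fin n → Fin m → ℝ := fun l i => w i / s i * rstar i * A i l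
  have hdot : ∀ τ, (Aᵀ * M τ * A) *ᵥ e ⬝ᵥ (Aᵀ * M τ) *ᵥ rstar =
      ∑ l, (q : ℝ)⁻¹ ^ 2 * ((∑ j, x l (τ j)) * ∑ k, y l (τ k)) := fun τ => by
    rw [← Matrix.mulVec_mulVec, hM, dotProduct]
    refine Finset.sum_congr rfl fun l _ => ?_
    rw [transpose_mul_sum_single_mulVec A _ (fun i => w i / s i),
      transpose_mul_sum_single_mulVec A _ (fun i => w i / s i)]
    ring
  have hy0 : ∀ l, ∑ i, p i * y l i = 0 := fun l => by
    have h : ∑ i, A i l * rstar i = 0 := congrFun hr l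
    rw [← mul_zero (α / F), ← h, Finset.mul_sum]
    refine Finset.sum_congr rfl fun i _ => ?_
    rw [← hc i]
    ring
  have hsum : ∑ l, ∑ i, p i * (x l i * y l i) = α / F * (u ⬝ᵥ Matrix.diagonal w *ᵥ rstar) := by
    rw [Finset.sum_comm, dotProduct, Finset.mul_sum]
    refine Finset.sum_congr rfl fun i _ => ?_
    calc ∑ l, p i * (x l i * y l i)
        = p i * (w i / s i) * (w i / s i * u i * rstar i) * s i := by
          rw [hs, Finset.mul_sum]
          exact Finset.sum_congr rfl fun l _ => by ring
      _ = α / F * (u i * (Matrix.diagonal w *ᵥ rstar) i) := by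
          rw [hc, Matrix.mulVec_diagonal]
          have := (hs_pos i).ne'
          field_simp
  have hq0 : (q : ℝ) ≠ 0 := by positivity
  calc ∑ τ : Fin q → Fin m, (∏ j, p (τ j)) * ((Aᵀ * M τ * A) *ᵥ e ⬝ᵥ (Aᵀ * M τ) *ᵥ rstar)
      = ∑ l, (q : ℝ)⁻¹ ^ 2 *
          ∑ τ : Fin q → Fin m, (∏ j, p (τ j)) * ((∑ j, x l (τ j)) * ∑ k, y l (τ k)) := by
        simp_rw [hdot, Finset.mul_sum (Finset.univ : Finset (Fin n))]
        rw [Finset.sum_comm]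
        refine Finset.sum_congr rfl fun l _ => ?_
        rw [Finset.mul_sum]
        exact Finset.sum_congr rfl fun τ _ => by ring
    _ = (q : ℝ)⁻¹ * ∑ l, ∑ i, p i * (x l i * y l i) := by
        rw [Finset.mul_sum]
        refine Finset.sum_congr rfl fun l _ => ?_
        rw [sum_prod_mul_sum_mul_sum p _ _ hp1 (hy0 l), Fintype.card_fin]
        field_simp
    _ = α / q * (u ⬝ᵥ Matrix.diagonal w *ᵥ rstar) / F := by
        rw [hsum]
        ring
end
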